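/- arXiv:1007.5265 — 4 statements merged into one kernel-verified Lean document; each statement's English description precedes it below -/
import Mathlib

section
/- Let R be an integral domain, * a star operation on R, and I a nonzero ideal of R. If I is *-stable, then I is Clifford *-regular. Consequently, if every nonzero ideal of R is *-stable, then R is a Clifford *-regular domain. -/
open scoped Pointwise

section Defs

variable (A K : Type*) [CommRing A] [Field K] [Algebra A K]

/-- `I` is a nonzero fractional ideal of `A` (inside `K`):
`I ≠ 0` and `dI ⊆ A` for some nonzero `d ∈ A`. -/
def IsFrac (I : Submodule A K) : Prop :=
  I ≠ ⊥ ∧ ∃ d : A, d ≠ 0 ∧ ∀ x ∈ I, ∃ a : A, algebraMap A K d * x = algebraMap A K a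

/-- The divisorial closure `I^v = (A : (A : I))`; here `(J : I) = J / I` and
`(1 : Submodule A K)` is the image of `A` in `K`. -/
def vS (I : Submodule A K) : Submodule A K := 1 / (1 / I)

/-- The `t`-operation `I^t = ⋃ {J^v : J ⊆ I nonzero finitely generated}` (a directed union,
hence equal to the supremum of submodules). -/
def tS (I : Submodule A K) : Submodule A K :=
  ⨆ J ∈ {J : Submodule A K | J ≠ ⊥ ∧ J.FG ∧ J ≤ I}, vS A K J

/-- The image of an integral ideal of `A` in `K`. -/
def idealK (I : Ideal A) : Submodule A K := Submodule.map (Algebra.linearMap A K) I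

/-- A nonzero (fractional) ideal `I` is stable if `I((I:I):I) = (I:I)`. -/
def IsStableIdeal (I : Submodule A K) : Prop := I * ((I / I) / I) = I / I

/-- `A` is a stable domain: every nonzero (fractional) ideal is stable. -/
def StableDomain : Prop := ∀ I : Submodule A K, IsFrac A K I → IsStableIdeal A K I

/-- `A` is Clifford regular: every nonzero (fractional) ideal `I` satisfies `I = I²J`
for some nonzero `A`-submodule `J` of `K`. -/
def CliffordRegularDomain : Prop :=
  ∀ I : Submodule A K, IsFrac A K I → ∃ J : Submodule A K, J ≠ ⊥ ∧ I = I * I * J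

end Defs
section Star

variable (R K : Type*) [CommRing R] [IsDomain R] [Field K] [Algebra R K] [IsFractionRing R K]

/-- A star operation on the domain `R` with quotient field `K`: a map on (nonzero)
fractional ideals satisfying `(aI)^* = aI^*`, `R^* = R`, `I ⊆ I^*`, monotonicity and
idempotency. -/
structure StarOperation : Type _ where
  star : Submodule R K → Submodule R K
  star_frac : ∀ I, IsFrac R K I → IsFrac R K (star I)
  star_smul : ∀ (a : K), a ≠ 0 → ∀ I, IsFrac R K I → star (a • I) = a • star I
  star_one : star (1 : Submodule R K) = 1
  le_star : ∀ I, IsFrac R K I → I ≤ star I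
  star_mono : ∀ I J, IsFrac R K I → IsFrac R K J → I ≤ J → star I ≤ star J
  star_star : ∀ I, IsFrac R K I → star (star I) = star I

variable {R K}

/-- `*` is of finite type: `I^* = ⋃ {J^* : J ⊆ I nonzero finitely generated}`. -/
def StarOperation.FiniteType (s : StarOperation R K) : Prop :=
  ∀ I, IsFrac R K I →
    s.star I = ⨆ J ∈ {J : Submodule R K | J ≠ ⊥ ∧ J.FG ∧ J ≤ I}, s.star J

/-- `I` is `*`-stable: with `E := (I^* : I^*)`, one has `(I^*(E : I^*))^* = E`. -/
def StarOperation.Stable (s : StarOperation R K) (I : Submodule R K) : Prop :=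
  s.star (s.star I * ((s.star I / s.star I) / s.star I)) = s.star I / s.star I

/-- `I` is Clifford `*`-regular: `I^* = (I²J)^*` for some nonzero ideal `J`. -/
def StarOperation.Regular (s : StarOperation R K) (I : Submodule R K) : Prop :=
  ∃ J : Submodule R K, IsFrac R K J ∧ s.star I = s.star (I * I * J)

/-- `I` is Boole `*`-regular: `(I²)^* = xI^*` for some nonzero `x ∈ K`. -/
def StarOperation.BooleRegular (s : StarOperation R K) (I : Submodule R K) : Prop :=
  ∃ x : K, x ≠ 0 ∧ s.star (I * I) = x • s.star I

/-- `I` is strongly `*`-stable: `I^* = xE` for some nonzero `x ∈ K`, where `E = (I^* : I^*)`. -/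
def StarOperation.StronglyStable (s : StarOperation R K) (I : Submodule R K) : Prop :=
  ∃ x : K, x ≠ 0 ∧ s.star I = x • (s.star I / s.star I)

end Star

lemma IsFrac.mul {R K : Type*} [CommRing R] [IsDomain R] [Field K] [Algebra R K]
    {I J : Submodule R K} (hI : IsFrac R K I) (hJ : IsFrac R K J) : IsFrac R K (I * J) := by
  obtain ⟨hI0, d, hd, hdI⟩ := hI
  obtain ⟨hJ0, e, he, heJ⟩ := hJ
  obtain ⟨x, hx, hx0⟩ := I.ne_bot_iff.1 hI0
  obtain ⟨y, hy, hy0⟩ := J.ne_bot_iff.1 hJ0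
  refine ⟨(Submodule.ne_bot_iff _).2 ⟨x * y, Submodule.mul_mem_mul hx hy, mul_ne_zero hx0 hy0⟩,
    d * e, mul_ne_zero hd he, fun z hz ↦ ?_⟩
  induction hz using Submodule.mul_induction_on' with
  | mem_mul_mem m hm n hn =>
    obtain ⟨a, ha⟩ := hdI m hm
    obtain ⟨b, hb⟩ := heJ n hn
    refine ⟨a * b, ?_⟩
    rw [map_mul, map_mul, ← ha, ← hb]
    ring
  | add m _ n _ hm hn =>
    obtain ⟨a, ha⟩ := hm
    obtain ⟨b, hb⟩ := hn
    exact ⟨a + b, by rw [map_add, ← ha, ← hb, mul_add]⟩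

lemma IsFrac.div {R K : Type*} [CommRing R] [IsDomain R] [Field K] [Algebra R K]
    [IsFractionRing R K] {I J : Submodule R K} (hI : IsFrac R K I) (hJ : IsFrac R K J) :
    IsFrac R K (I / J) := by
  obtain ⟨hI0, d, hd, hdI⟩ := hI
  obtain ⟨hJ0, e, he, heJ⟩ := hJ
  obtain ⟨x, hx, hx0⟩ := I.ne_bot_iff.1 hI0
  obtain ⟨y, hy, hy0⟩ := J.ne_bot_iff.1 hJ0
  have hinj := IsFractionRing.injective R K
  refine ⟨(Submodule.ne_bot_iff _).2 ⟨algebraMap R K e * x, ?_, mul_ne_zero ?_ hx0⟩, ?_⟩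
  · rw [Submodule.mem_div_iff_forall_mul_mem]
    intro z hz
    obtain ⟨a, ha⟩ := heJ z hz
    rw [mul_right_comm, ha, ← Algebra.smul_def]
    exact I.smul_mem a hx
  · exact (map_ne_zero_iff _ hinj).2 he
  · obtain ⟨p, q, hq, rfl⟩ := IsFractionRing.div_surjective (A := R) y
    have hq0 : algebraMap R K q ≠ 0 := (map_ne_zero_iff _ hinj).2 (nonZeroDivisors.ne_zero hq)
    have hp : p ≠ 0 := by
      rintro rfl
      simp at hy0
    refine ⟨d * p, mul_ne_zero hd hp, fun z hz ↦ ?_⟩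
    obtain ⟨a, ha⟩ := hdI _ (Submodule.mem_div_iff_forall_mul_mem.1 hz _ hy)
    refine ⟨a * q, ?_⟩
    rw [map_mul, map_mul, ← ha]
    field_simp

namespace StarOperation

variable {R K : Type*} [CommRing R] [IsDomain R] [Field K] [Algebra R K]

lemma star_mul_le (s : StarOperation R K) {I J : Submodule R K} (hI : IsFrac R K I)
    (hJ : IsFrac R K J) : s.star I * J ≤ s.star (I * J) := by
  rw [Submodule.mul_le]
  intro x hx y hy
  obtain rfl | hy0 := eq_or_ne y 0
  · simp
  have hle : y • I ≤ I * J := by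
    rintro _ ⟨z, hz, rfl⟩
    change y * z ∈ I * J
    rw [mul_comm y z]
    exact Submodule.mul_mem_mul hz hy
  have hfrac : IsFrac R K (y • I) := by
    obtain ⟨z, hz, hz0⟩ := I.ne_bot_iff.1 hI.1
    obtain ⟨-, d, hd, h⟩ := hI.mul hJ
    exact ⟨(Submodule.ne_bot_iff _).2
      ⟨y • z, Submodule.smul_mem_pointwise_smul z y I hz, mul_ne_zero hy0 hz0⟩,
      d, hd, fun w hw ↦ h w (hle hw)⟩
  have h := s.star_mono _ _ hfrac (hI.mul hJ) hle
  rw [s.star_smul y hy0 I hI] at h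
  rw [mul_comm x y]
  exact h (Submodule.smul_mem_pointwise_smul x y _ hx)

lemma star_star_mul (s : StarOperation R K) {I J : Submodule R K} (hI : IsFrac R K I)
    (hJ : IsFrac R K J) : s.star (s.star I * J) = s.star (I * J) := by
  have hIJ := hI.mul hJ
  have hsIJ := (s.star_frac I hI).mul hJ
  apply le_antisymm
  · rw [← s.star_star _ hIJ]
    exact s.star_mono _ _ hsIJ (s.star_frac _ hIJ) (s.star_mul_le hI hJ)
  · exact s.star_mono _ _ hIJ hsIJ (mul_le_mul_left (s.le_star I hI) J)

lemma star_mul_star (s : StarOperation R K) {I J : Submodule R K} (hI : IsFrac R K I)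
    (hJ : IsFrac R K J) : s.star (I * s.star J) = s.star (I * J) := by
  rw [mul_comm, s.star_star_mul hJ hI, mul_comm]

lemma Stable.regular [IsFractionRing R K] {s : StarOperation R K} {I : Submodule R K} (hI : IsFrac R K I)
    (h : s.Stable I) : s.Regular I := by
  have hL := s.star_frac I hI
  have hE := hL.div hL
  have hJ := hE.div hL
  have hmul : s.star I * (s.star I / s.star I) = s.star I := by
    apply le_antisymm
    · rw [mul_comm]
      exact Submodule.le_div_iff_mul_le.1 le_rfl
    · intro x hx
      rw [← mul_one x]
      refine Submodule.mul_mem_mul hx ?_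
      rw [Submodule.mem_div_iff_forall_mul_mem]
      intro y hy
      rwa [one_mul]
  refine ⟨_, hJ, ?_⟩
  rw [mul_assoc, ← s.star_star_mul hI (hI.mul hJ), ← s.star_mul_star hL (hI.mul hJ),
    ← s.star_star_mul hI hJ, h, hmul, s.star_star I hI]

end StarOperation

/-- If a nonzero (fractional) ideal `I` of `R` is `*`-stable, then it is
Clifford `*`-regular; consequently, if every nonzero ideal of `R` is `*`-stable, then `R` is
a Clifford `*`-regular domain. -/
theorem star_stable_implies_clifford_regular
    {R K : Type*} [CommRing R] [IsDomain R] [Field K] [Algebra R K] [IsFractionRing R K]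
    (s : StarOperation R K) :
    (∀ I : Submodule R K, IsFrac R K I → s.Stable I → s.Regular I) ∧
      ((∀ I : Submodule R K, IsFrac R K I → s.Stable I) →
        ∀ I : Submodule R K, IsFrac R K I → s.Regular I) := by
  exact ⟨fun _ hI h ↦ h.regular hI, fun h I hI ↦ (h I hI).regular hI⟩
end

section
/- Let R ⊆ D be an extension of integral domains with the same quotient field K, let *₁ be a semistar operation on R and *₂ a semistar operation on D. Then the extension is (*₁,*₂)-compatible, i.e. (FD)^{*₂} = (F^{*₁}D)^{*₂} for every nonzero R-submodule F of K, if and only if F^{*₁} ⊆ F^{*₂} for every nonzero D-submodule F of K. -/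
open scoped Pointwise

section Semistar

variable (A K : Type*) [CommRing A] [Field K] [Algebra A K]

/-- A semistar operation on the domain `A` (inside `K`): a map on nonzero `A`-submodules of
`K` satisfying `(aF)^* = aF^*`, `F ⊆ F^*`, monotonicity, and idempotency. -/
structure SemistarOp : Type _ where
  star : Submodule A K → Submodule A K
  star_ne_bot : ∀ F : Submodule A K, F ≠ ⊥ → star F ≠ ⊥
  star_smul : ∀ (a : K), a ≠ 0 → ∀ F : Submodule A K, F ≠ ⊥ → star (a • F) = a • star F
  le_star : ∀ F : Submodule A K, F ≠ ⊥ → F ≤ star F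
  star_mono : ∀ F G : Submodule A K, F ≠ ⊥ → G ≠ ⊥ → F ≤ G → star F ≤ star G
  star_star : ∀ F : Submodule A K, F ≠ ⊥ → star (star F) = star F

end Semistar

/-- Let `R ⊆ D` be an extension of domains with the same quotient field `K`
(so `D` is an overring of `R` inside `K`), `*₁` a semistar operation on `R` and `*₂` a
semistar operation on `D`. The extension is `(*₁,*₂)`-compatible, i.e.
`(FD)^{*₂} = (F^{*₁}D)^{*₂}` for every nonzero `R`-submodule `F` of `K`, if and only if
`F^{*₁} ⊆ F^{*₂}` for every nonzero `D`-submodule `F` of `K`. -/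
theorem semistar_compatible_iff
    {R K : Type*} [CommRing R] [IsDomain R] [Field K] [Algebra R K] [IsFractionRing R K]
    (D : Subalgebra R K) (s₁ : SemistarOp R K) (s₂ : SemistarOp D K) :
    (∀ F : Submodule R K, F ≠ ⊥ →
        s₂.star (Submodule.span D (F : Set K)) =
          s₂.star (Submodule.span D ((s₁.star F : Submodule R K) : Set K))) ↔
      (∀ F : Submodule D K, F ≠ ⊥ →
        s₁.star (F.restrictScalars R) ≤ (s₂.star F).restrictScalars R) := by
  have span_ne_bot : ∀ G : Submodule R K, G ≠ ⊥ → Submodule.span D (G : Set K) ≠ ⊥ := by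
    intro G hG h
    rw [Submodule.span_eq_bot] at h
    exact hG ((Submodule.eq_bot_iff G).2 h)
  constructor
  · intro h F hF x hx
    have hF' : F.restrictScalars R ≠ ⊥ := by
      rwa [Ne, Submodule.restrictScalars_eq_bot_iff]
    have key := h (F.restrictScalars R) hF'
    rw [Submodule.coe_restrictScalars, Submodule.span_eq] at key
    change x ∈ s₂.star F
    rw [key]
    exact s₂.le_star _ (span_ne_bot _ (s₁.star_ne_bot _ hF')) (Submodule.subset_span hx)
  · intro h F hF
    have hFD := span_ne_bot F hF
    have hsFD := span_ne_bot _ (s₁.star_ne_bot F hF)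
    have hres : (Submodule.span D (F : Set K)).restrictScalars R ≠ ⊥ := by
      rwa [Ne, Submodule.restrictScalars_eq_bot_iff]
    apply le_antisymm
    · exact s₂.star_mono _ _ hFD hsFD (Submodule.span_mono (s₁.le_star F hF))
    · rw [← s₂.star_star (Submodule.span D (F : Set K)) hFD]
      refine s₂.star_mono _ _ hsFD (s₂.star_ne_bot _ hFD) (Submodule.span_le.2 fun x hx => ?_)
      exact h _ hFD (s₁.star_mono F _ hF hres (fun _ hy => Submodule.subset_span hy) hx)
end

section
/- Let R ⊆ D be an extension of integral domains with the same quotient field K, let t_R be the t-semistar operation of R and t_D the t-semistar operation of D. Then the extension is t-compatible, i.e. (FD)^{t_D} = (F^{t_R}D)^{t_D} for every nonzero R-submodule F of K, if and only if D^{t_R} = D. -/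
open scoped Pointwise

section Closure

variable {A K : Type*} [CommRing A] [Field K] [Algebra A K]

theorem le_vS (I : Submodule A K) : I ≤ vS A K I := fun x hx y hy => by
  simpa only [mul_comm x y] using Submodule.mem_div_iff_forall_mul_mem.1 hy x hx

theorem vS_mono {I J : Submodule A K} (h : I ≤ J) : vS A K I ≤ vS A K J :=
  fun _ hx _ hy => hx _ fun z hz => hy z (h hz)

theorem vS_vS (I : Submodule A K) : vS A K (vS A K I) = vS A K I :=
  le_antisymm (fun _ hx _ hy => hx _ fun z hz => by
    simpa only [mul_comm z] using Submodule.mem_div_iff_forall_mul_mem.1 hz _ hy) (le_vS _)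

theorem vS_le_one {I : Submodule A K} (h : I ≤ 1) : vS A K I ≤ 1 := fun x hx => by
  simpa only [mul_one] using
    Submodule.mem_div_iff_forall_mul_mem.1 hx 1 (Submodule.one_mem_div.2 h)

/-- Multiplication by `y` maps `I^v` into `(yI)^v`. -/
theorem mul_mem_vS_map_mulLeft {I : Submodule A K} {x : K} (y : K) (hx : x ∈ vS A K I) :
    y * x ∈ vS A K (I.map (LinearMap.mulLeft A y)) := fun z hz => by
  have := Submodule.mem_div_iff_forall_mul_mem.1 hx (z * y) fun w hw => by
    simpa only [LinearMap.mulLeft_apply, mul_assoc] using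
      Submodule.mem_div_iff_forall_mul_mem.1 hz _ (Submodule.mem_map_of_mem hw)
  simpa only [mul_comm, mul_left_comm] using this

theorem vS_le_tS {I J : Submodule A K} (hJ : J ≠ ⊥) (hfg : J.FG) (h : J ≤ I) :
    vS A K J ≤ tS A K I :=
  le_iSup₂_of_le (f := fun J (_ : J ∈ {J : Submodule A K | J ≠ ⊥ ∧ J.FG ∧ J ≤ I}) => vS A K J)
    J ⟨hJ, hfg, h⟩ le_rfl

theorem tS_le_iff {I L : Submodule A K} :
    tS A K I ≤ L ↔ ∀ J : Submodule A K, J ≠ ⊥ → J.FG → J ≤ I → vS A K J ≤ L := by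
  simp only [tS, iSup_le_iff, Set.mem_ofPred_eq, and_imp]

theorem tS_mono {I J : Submodule A K} (h : I ≤ J) : tS A K I ≤ tS A K J :=
  tS_le_iff.2 fun _ h0 hfg hle => vS_le_tS h0 hfg (hle.trans h)

theorem le_tS (I : Submodule A K) : I ≤ tS A K I := fun x hx => by
  rcases eq_or_ne x 0 with rfl | h0
  · exact zero_mem _
  · exact vS_le_tS (mt Submodule.span_singleton_eq_bot.1 h0) (Submodule.fg_span_singleton x)
      ((Submodule.span_singleton_le_iff_mem _ _).2 hx)
      (le_vS _ (Submodule.mem_span_singleton_self x))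

theorem tS_one_le : tS A K 1 ≤ 1 := tS_le_iff.2 fun _ _ _ => vS_le_one

/-- A nonzero finitely generated submodule of `I^t` lies in `L^v` for a single nonzero finitely
generated `L ≤ I`. -/
theorem exists_le_vS_of_le_tS {I J : Submodule A K} (h0 : J ≠ ⊥) (hfg : J.FG)
    (h : J ≤ tS A K I) : ∃ L : Submodule A K, L ≠ ⊥ ∧ L.FG ∧ L ≤ I ∧ J ≤ vS A K L := by
  rw [tS, ← sSup_image] at h
  have hne : (vS A K '' {J | J ≠ ⊥ ∧ J.FG ∧ J ≤ I}).Nonempty := by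
    by_contra hs
    rw [Set.not_nonempty_iff_eq_empty.1 hs, sSup_empty] at h
    exact h0 (le_bot_iff.1 h)
  have hdir : DirectedOn (· ≤ ·) (vS A K '' {J | J ≠ ⊥ ∧ J.FG ∧ J ≤ I}) := by
    rintro _ ⟨L, ⟨hL0, hL, hLI⟩, rfl⟩ _ ⟨M, ⟨-, hM, hMI⟩, rfl⟩
    exact ⟨_, ⟨L ⊔ M, ⟨fun e => hL0 (sup_eq_bot_iff.1 e).1, hL.sup hM, sup_le hLI hMI⟩, rfl⟩,
      vS_mono le_sup_left, vS_mono le_sup_right⟩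
  obtain ⟨_, ⟨L, ⟨hL0, hL, hLI⟩, rfl⟩, hJL⟩ :=
    (CompleteLattice.isCompactElement_iff_le_of_directed_sSup_le _ _).1
      ((Submodule.fg_iff_compact J).1 hfg) _ hne hdir h
  exact ⟨L, hL0, hL, hLI, hJL⟩

theorem tS_tS (I : Submodule A K) : tS A K (tS A K I) = tS A K I := by
  refine le_antisymm (tS_le_iff.2 fun J h0 hfg h => ?_) (le_tS _)
  obtain ⟨L, hL0, hL, hLI, hJL⟩ := exists_le_vS_of_le_tS h0 hfg h
  exact ((vS_mono hJL).trans_eq (vS_vS L)).trans (vS_le_tS hL0 hL hLI)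

end Closure

section Overring

variable {R K : Type*} [CommRing R] [Field K] [Algebra R K] (D : Subalgebra R K)

theorem Subalgebra.mem_one_submodule {x : K} : x ∈ (1 : Submodule D K) ↔ x ∈ D := by
  rw [Submodule.mem_one]
  exact ⟨fun ⟨y, hy⟩ => hy ▸ y.2, fun hx => ⟨⟨x, hx⟩, rfl⟩⟩

theorem vS_subset_vS_span (hD : tS R K (Subalgebra.toSubmodule D) = Subalgebra.toSubmodule D)
    {J : Submodule R K} (h0 : J ≠ ⊥) (hfg : J.FG) :
    (vS R K J : Set K) ⊆ vS D K (Submodule.span D (J : Set K)) := by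
  intro x hx y hy
  rw [mul_comm]
  rcases eq_or_ne y 0 with rfl | hy0
  · simp only [zero_mul]
    exact zero_mem (1 : Submodule D K)
  refine (D.mem_one_submodule).2 (hD.le ?_)
  refine vS_le_tS (J := J.map (LinearMap.mulLeft R y)) ?_ (hfg.map _) ?_
    (mul_mem_vS_map_mulLeft y hx)
  · obtain ⟨z, hz, hz0⟩ := Submodule.exists_mem_ne_zero_of_ne_bot h0
    exact (Submodule.ne_bot_iff _).2 ⟨y * z, Submodule.mem_map_of_mem hz, mul_ne_zero hy0 hz0⟩
  · rintro _ ⟨z, hz, rfl⟩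
    exact (D.mem_one_submodule).1 (hy z (Submodule.subset_span hz))

theorem tS_subset_tS_span (hD : tS R K (Subalgebra.toSubmodule D) = Subalgebra.toSubmodule D)
    (F : Submodule R K) : (tS R K F : Set K) ⊆ tS D K (Submodule.span D (F : Set K)) := by
  suffices tS R K F ≤ (tS D K (Submodule.span D (F : Set K))).restrictScalars R from this
  refine tS_le_iff.2 fun J h0 hfg hJ x hx => ?_
  refine vS_le_tS (J := Submodule.span D (J : Set K)) ?_ ?_ (Submodule.span_mono hJ)
    (vS_subset_vS_span D hD h0 hfg hx)
  · obtain ⟨z, hz, hz0⟩ := Submodule.exists_mem_ne_zero_of_ne_bot h0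
    exact (Submodule.ne_bot_iff _).2 ⟨z, Submodule.subset_span hz, hz0⟩
  · obtain ⟨s, rfl⟩ := hfg
    exact ⟨s, (Submodule.span_span_of_tower R D (s : Set K)).symm⟩

end Overring

/-- Let `R ⊆ D` be an extension of domains with the same quotient field `K`
(so `D` is an overring of `R` inside `K`). The extension is `t`-compatible, i.e.
`(FD)^{t_D} = (F^{t_R}D)^{t_D}` for every nonzero `R`-submodule `F` of `K`, if and only if
`D^{t_R} = D`. -/
theorem t_compatible_iff_tStar_eq
    {R K : Type*} [CommRing R] [IsDomain R] [Field K] [Algebra R K] [IsFractionRing R K]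
    (D : Subalgebra R K) :
    (∀ F : Submodule R K, F ≠ ⊥ →
        tS D K (Submodule.span D (F : Set K)) =
          tS D K (Submodule.span D ((tS R K F : Submodule R K) : Set K))) ↔
      tS R K (Subalgebra.toSubmodule D) = Subalgebra.toSubmodule D := by
  constructor
  · intro h
    refine le_antisymm (fun x hx => ?_) (le_tS _)
    have hne : Subalgebra.toSubmodule D ≠ ⊥ :=
      (Submodule.ne_bot_iff _).2 ⟨1, D.one_mem, one_ne_zero⟩
    have hspan : Submodule.span D ((Subalgebra.toSubmodule D : Submodule R K) : Set K) ≤ 1 :=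
      Submodule.span_le.2 fun y hy => D.mem_one_submodule.2 hy
    refine D.mem_one_submodule.1 (tS_one_le (tS_mono hspan ?_))
    rw [h _ hne]
    exact le_tS _ (Submodule.subset_span hx)
  · intro hD F _
    refine le_antisymm (tS_mono (Submodule.span_mono (le_tS F))) ?_
    exact (tS_mono (Submodule.span_le.2 (tS_subset_tS_span D hD F))).trans_eq (tS_tS _)
end

section
/- Let R be an h-local domain, i.e. every nonzero element of R lies in only finitely many maximal ideals of R and every nonzero prime ideal of R is contained in a unique maximal ideal. Then R is Clifford regular if and only if R_M is Clifford regular for every maximal ideal M of R, and R is stable if and only if R_M is stable for every maximal ideal M of R. -/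
open scoped Pointwise

/-- The localization `R_P ⊆ K` of `R` at the prime `P`: the subring of `K` generated by `R`
and the inverses of the elements of `R ∖ P`. -/
def locAlg (R K : Type*) [CommRing R] [Field K] [Algebra R K] (P : Ideal R) :
    Subalgebra R K :=
  Algebra.adjoin R {y : K | ∃ s : R, s ∉ P ∧ y = (algebraMap R K s)⁻¹}

section Submodules

variable {A K : Type*} [CommRing A] [Field K] [Algebra A K]

lemma Submodule.div_div_eq_div_mul (I J L : Submodule A K) : I / J / L = I / (L * J) :=
  eq_of_forall_le_iff fun D => by
    rw [Submodule.le_div_iff_mul_le, Submodule.le_div_iff_mul_le, Submodule.le_div_iff_mul_le,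
      mul_assoc]

lemma isStableIdeal_iff_one_mem (I : Submodule A K) :
    IsStableIdeal A K I ↔ (1 : K) ∈ I * (I / (I * I)) := by
  rw [IsStableIdeal, Submodule.div_div_eq_div_mul]
  constructor
  · intro h
    rw [h, Submodule.mem_div_iff_forall_mul_mem]
    simp
  · intro h
    apply le_antisymm
    · rw [Submodule.le_div_iff_mul_le]
      calc I * (I / (I * I)) * I = I / (I * I) * (I * I) := by ring
        _ ≤ I := Submodule.le_div_iff_mul_le.mp le_rfl
    · intro z hz
      have hle : I / I * (I * (I / (I * I))) ≤ I * (I / (I * I)) := by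
        rw [← mul_assoc]
        exact mul_le_mul_left (Submodule.le_div_iff_mul_le.mp le_rfl) _
      simpa using hle (Submodule.mul_mem_mul hz h)

lemma eq_mul_mul_div_of_eq_mul_mul {I J : Submodule A K} (h : I = I * I * J) :
    I = I * I * (I / (I * I)) := by
  apply le_antisymm
  · have hJ : J ≤ I / (I * I) := by
      rw [Submodule.le_div_iff_mul_le, mul_comm, ← h]
    conv_lhs => rw [h]
    exact mul_le_mul_right hJ _
  · rw [mul_comm]
    exact Submodule.le_div_iff_mul_le.mp le_rfl

end Submodules

section Localization

variable {R K : Type*} [CommRing R] [Field K] [Algebra R K]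

lemma inv_mem_locAlg {P : Ideal R} {s : R} (hs : s ∉ P) : (algebraMap R K s)⁻¹ ∈ locAlg R K P :=
  Algebra.subset_adjoin ⟨s, hs, rfl⟩

variable [IsFractionRing R K]

lemma algebraMap_ne_zero_of_notMem {P : Ideal R} {s : R} (hs : s ∉ P) : algebraMap R K s ≠ 0 := by
  rw [Ne, FaithfulSMul.algebraMap_eq_zero_iff]
  rintro rfl
  exact hs P.zero_mem

lemma mem_of_smul_mem_of_notMem {P : Ideal R} {X : Submodule (locAlg R K P) K} {s : R} (hs : s ∉ P) {z : K}
    (hz : s • z ∈ X) : z ∈ X := by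
  have h := X.smul_mem (⟨_, inv_mem_locAlg hs⟩ : locAlg R K P) hz
  rwa [Subalgebra.smul_def, smul_eq_mul, Algebra.smul_def,
    inv_mul_cancel_left₀ (algebraMap_ne_zero_of_notMem hs)] at h

lemma exists_algebraMap_mul_eq_of_mem_locAlg {P : Ideal R} [hP : P.IsPrime] {x : K}
    (hx : x ∈ locAlg R K P) : ∃ s ∉ P, ∃ r : R, algebraMap R K s * x = algebraMap R K r := by
  induction hx using Algebra.adjoin_induction with
  | mem x hx =>
    obtain ⟨s, hs, rfl⟩ := hx
    exact ⟨s, hs, 1, by simp [mul_inv_cancel₀ (algebraMap_ne_zero_of_notMem (K := K) hs)]⟩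
  | algebraMap r => exact ⟨1, hP.one_notMem, r, by simp⟩
  | add x y _ _ ihx ihy =>
    obtain ⟨s, hs, a, ha⟩ := ihx
    obtain ⟨t, ht, b, hb⟩ := ihy
    refine ⟨s * t, hP.mul_notMem hs ht, t * a + s * b, ?_⟩
    simp only [map_mul, map_add, ← ha, ← hb]
    ring
  | mul x y _ _ ihx ihy =>
    obtain ⟨s, hs, a, ha⟩ := ihx
    obtain ⟨t, ht, b, hb⟩ := ihy
    refine ⟨s * t, hP.mul_notMem hs ht, a * b, ?_⟩
    simp only [map_mul, ← ha, ← hb]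
    ring

/-- The localization `I R_P ⊆ K` of an `R`-submodule `I` of `K` at the prime `P`. -/
def locSubmodule (P : Ideal R) [hP : P.IsPrime] (I : Submodule R K) :
    Submodule (locAlg R K P) K where
  carrier := {z | ∃ s ∉ P, s • z ∈ I}
  zero_mem' := ⟨1, hP.one_notMem, by simp⟩
  add_mem' := by
    rintro x y ⟨s, hs, hx⟩ ⟨t, ht, hy⟩
    refine ⟨s * t, hP.mul_notMem hs ht, ?_⟩
    rw [smul_add]
    refine I.add_mem ?_ ?_
    · rw [mul_comm, mul_smul]
      exact I.smul_mem _ hx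
    · rw [mul_smul]
      exact I.smul_mem _ hy
  smul_mem' := by
    rintro ⟨a, ha⟩ x ⟨s, hs, hx⟩
    obtain ⟨t, ht, r, hr⟩ := exists_algebraMap_mul_eq_of_mem_locAlg ha
    refine ⟨t * s, hP.mul_notMem ht hs, ?_⟩
    have : (t * s) • ((⟨a, ha⟩ : locAlg R K P) • x) = r • s • x := by
      rw [Subalgebra.smul_def, smul_eq_mul]
      simp only [Algebra.smul_def, map_mul, ← hr]
      ring
    rw [this]
    exact I.smul_mem _ hx

variable {P : Ideal R} [hP : P.IsPrime]

lemma mem_locSubmodule_of_mem {I : Submodule R K} {z : K} (hz : z ∈ I) : z ∈ locSubmodule P I :=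
  ⟨1, hP.one_notMem, by simpa⟩

lemma locSubmodule_mono {I J : Submodule R K} (h : I ≤ J) :
    locSubmodule P I ≤ locSubmodule P J := fun _ ⟨s, hs, hz⟩ => ⟨s, hs, h hz⟩

lemma locSubmodule_mul (I J : Submodule R K) :
    locSubmodule P (I * J) = locSubmodule P I * locSubmodule P J := by
  apply le_antisymm
  · rintro z ⟨s, hs, hz⟩
    refine mem_of_smul_mem_of_notMem hs ?_
    exact Submodule.mul_induction_on hz
      (fun x hx y hy =>
        Submodule.mul_mem_mul (mem_locSubmodule_of_mem hx) (mem_locSubmodule_of_mem hy))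
      fun x y hx hy => add_mem hx hy
  · rw [Submodule.mul_le]
    rintro x ⟨s, hs, hx⟩ y ⟨t, ht, hy⟩
    refine ⟨s * t, hP.mul_notMem hs ht, ?_⟩
    rw [← smul_mul_smul_comm]
    exact Submodule.mul_mem_mul hx hy

lemma locSubmodule_div_le (I J : Submodule R K) :
    locSubmodule P (I / J) ≤ locSubmodule P I / locSubmodule P J := by
  rw [Submodule.le_div_iff_mul_le, ← locSubmodule_mul]
  exact locSubmodule_mono (Submodule.le_div_iff_mul_le.mp le_rfl)

lemma IsFrac.locSubmodule {I : Submodule R K} (hI : IsFrac R K I) :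
    IsFrac (locAlg R K P) K (locSubmodule P I) := by
  obtain ⟨hI0, d, hd, h⟩ := hI
  constructor
  · obtain ⟨x, hx, hx0⟩ := Submodule.exists_mem_ne_zero_of_ne_bot hI0
    exact (Submodule.ne_bot_iff _).mpr ⟨x, mem_locSubmodule_of_mem hx, hx0⟩
  · refine ⟨algebraMap R _ d, ?_, ?_⟩
    · intro h0
      have h1 : algebraMap R K d = 0 := congrArg Subtype.val h0
      rw [FaithfulSMul.algebraMap_eq_zero_iff] at h1
      exact hd h1
    · rintro z ⟨s, hs, hz⟩
      obtain ⟨a, ha⟩ := h _ hz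
      refine ⟨⟨_, mul_mem (inv_mem_locAlg hs) (algebraMap_mem _ a)⟩, ?_⟩
      change algebraMap R K d * z = (algebraMap R K s)⁻¹ * algebraMap R K a
      rw [← ha, Algebra.smul_def]
      field_simp [algebraMap_ne_zero_of_notMem (K := K) hs]

lemma exists_isFrac_locSubmodule_eq {X : Submodule (locAlg R K P) K}
    (hX : IsFrac (locAlg R K P) K X) :
    ∃ I : Submodule R K, IsFrac R K I ∧ locSubmodule P I = X := by
  obtain ⟨hX0, d, hd, h⟩ := hX
  obtain ⟨t, ht, c, hc⟩ := exists_algebraMap_mul_eq_of_mem_locAlg d.2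
  have hc0 : c ≠ 0 := by
    rintro rfl
    have h0 := mul_ne_zero (algebraMap_ne_zero_of_notMem (K := K) ht)
      (fun h => hd (Subtype.ext h))
    exact h0 (by simpa using hc)
  let I : Submodule R K :=
    X.restrictScalars R ⊓ (1 : Submodule R K).comap (LinearMap.mulLeft R (algebraMap R K c))
  have hloc : locSubmodule P I = X := by
    apply le_antisymm
    · rintro z ⟨s, hs, hz⟩
      exact mem_of_smul_mem_of_notMem hs hz.1
    · intro z hz
      obtain ⟨a, ha⟩ := h z hz
      obtain ⟨s, hs, r, hr⟩ := exists_algebraMap_mul_eq_of_mem_locAlg a.2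
      refine ⟨s, hs, (X.restrictScalars R).smul_mem s hz, ?_⟩
      change algebraMap R K c * (s • z) ∈ (1 : Submodule R K)
      rw [Submodule.mem_one]
      refine ⟨t * r, ?_⟩
      have ha' : (d : K) * z = a := ha
      rw [map_mul, ← hr, ← hc, ← ha', Algebra.smul_def]
      ring
  refine ⟨I, ⟨?_, c, hc0, ?_⟩, hloc⟩
  · intro h0
    apply hX0
    rw [← hloc, h0, eq_bot_iff]
    rintro z ⟨s, hs, hz⟩
    rw [Submodule.mem_bot, Algebra.smul_def] at hz
    exact (mul_eq_zero.mp hz).resolve_left (algebraMap_ne_zero_of_notMem hs)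
  · intro x hx
    obtain ⟨a, ha⟩ := Submodule.mem_one.mp hx.2
    exact ⟨a, ha.symm⟩

lemma mem_of_forall_mem_locSubmodule {I : Submodule R K} {z : K}
    (h : ∀ (M : Ideal R) [M.IsMaximal], z ∈ locSubmodule M I) : z ∈ I := by
  by_contra hz
  have hne : I.comap (LinearMap.toSpanSingleton R K z) ≠ ⊤ := by
    intro h1
    apply hz
    have := (Ideal.eq_top_iff_one (I.comap (LinearMap.toSpanSingleton R K z))).mp h1
    simpa using this
  obtain ⟨M, hM, hle⟩ := Ideal.exists_le_maximal _ hne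
  obtain ⟨s, hs, hsz⟩ := h M
  exact hs (hle (by simpa using hsz))

end Localization

section HLocal

variable {R : Type*} [CommRing R]

lemma exists_mul_eq_mul_of_ne
    (huniq : ∀ P : Ideal R, P.IsPrime → P ≠ ⊥ → ∃! M : Ideal R, M.IsMaximal ∧ P ≤ M)
    {M N : Ideal R} (hM : M.IsMaximal) (hN : N.IsMaximal) (hMN : N ≠ M) {e : R} (he : e ≠ 0) :
    ∃ m ∉ M, ∃ n ∉ N, e ∣ n * m := by
  by_contra! hcon
  have hdisj : Disjoint (Ideal.span {e} : Set R)
      (M.primeCompl ⊔ N.primeCompl : Submonoid R) := by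
    rw [Set.disjoint_left]
    intro x hx hx'
    obtain ⟨m, hm, n, hn, rfl⟩ := Submonoid.mem_sup.mp hx'
    exact hcon m hm n hn (mul_comm m n ▸ Ideal.mem_span_singleton.mp hx)
  obtain ⟨P, hP, heP, hPd⟩ := Ideal.exists_le_prime_disjoint _ _ hdisj
  have hP0 : P ≠ ⊥ := by
    rintro rfl
    exact he (heP (Ideal.mem_span_singleton_self e))
  rw [Set.disjoint_left] at hPd
  have hPM : P ≤ M := fun x hx => by
    by_contra h
    exact hPd hx (Submonoid.mem_sup_left h)
  have hPN : P ≤ N := fun x hx => by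
    by_contra h
    exact hPd hx (Submonoid.mem_sup_right h)
  exact hMN ((huniq P hP hP0).unique ⟨hN, hPN⟩ ⟨hM, hPM⟩)

/-- In an h-local domain, a nonzero `e` divides, locally at all maximal ideals other than `M`,
some element outside `M`. -/
lemma exists_notMem_forall_dvd_mul
    (hfin : ∀ r : R, r ≠ 0 → {M : Ideal R | M.IsMaximal ∧ r ∈ M}.Finite)
    (huniq : ∀ P : Ideal R, P.IsPrime → P ≠ ⊥ → ∃! M : Ideal R, M.IsMaximal ∧ P ≤ M)
    {M : Ideal R} (hM : M.IsMaximal) {e : R} (he : e ≠ 0) :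
    ∃ s ∉ M, ∀ N : Ideal R, N.IsMaximal → N ≠ M → ∃ n ∉ N, e ∣ n * s := by
  choose! m hm n hn hdvd using fun N (hN : N.IsMaximal ∧ N ≠ M) =>
    exists_mul_eq_mul_of_ne huniq hM hN.1 hN.2 he
  have hF : {N : Ideal R | (N.IsMaximal ∧ N ≠ M) ∧ e ∈ N}.Finite :=
    (hfin e he).subset fun N hN => ⟨hN.1.1, hN.2⟩
  refine ⟨∏ N ∈ hF.toFinset, m N, ?_, ?_⟩
  · intro h
    obtain ⟨N, hN, hmN⟩ := (hM.isPrime.prod_mem_iff).mp h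
    exact hm N (hF.mem_toFinset.mp hN).1 hmN
  · intro N hN hNM
    by_cases heN : e ∈ N
    · refine ⟨n N, hn N ⟨hN, hNM⟩, (hdvd N ⟨hN, hNM⟩).trans (mul_dvd_mul_left _ ?_)⟩
      exact Finset.dvd_prod_of_mem m (hF.mem_toFinset.mpr ⟨⟨hN, hNM⟩, heN⟩)
    · exact ⟨e, heN, dvd_mul_right _ _⟩

variable {K : Type*} [IsDomain R] [Field K] [Algebra R K] [IsFractionRing R K]

lemma exists_smul_mul_mul_mem {I : Submodule R K} (hI : IsFrac R K I) (x : K) :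
    ∃ e : R, e ≠ 0 ∧ ∀ y ∈ I * I, e • (x * y) ∈ I := by
  obtain ⟨hI0, d, hd, h⟩ := hI
  obtain ⟨c, hc, hc0⟩ := Submodule.exists_mem_ne_zero_of_ne_bot hI0
  obtain ⟨a, ha⟩ := h c hc
  obtain ⟨p, b, hb, rfl⟩ := IsFractionRing.div_surjective (A := R) x
  have hinj := FaithfulSMul.algebraMap_injective R K
  have hd' : algebraMap R K d ≠ 0 := by simpa using hd
  have hb0 : b ≠ 0 := nonZeroDivisors.ne_zero hb
  have hb' : algebraMap R K b ≠ 0 := by simpa using hb0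
  have ha0 : a ≠ 0 := by
    rintro rfl
    exact mul_ne_zero hd' hc0 (by simpa using ha)
  refine ⟨a * b * d * d, by simp [ha0, hb0, hd], fun y hy => ?_⟩
  induction hy using Submodule.mul_induction_on' with
  | mem_mul_mem u hu v hv =>
    obtain ⟨r, hr⟩ := h u hu
    obtain ⟨q, hq⟩ := h v hv
    have : (a * b * d * d) • (algebraMap R K p / algebraMap R K b * (u * v)) =
        (d * p * r * q) • c := by
      simp only [Algebra.smul_def, map_mul, ← ha, ← hr, ← hq]
      field_simp
    rw [this]
    exact I.smul_mem _ hc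
  | add u _ v _ hu hv =>
    rw [mul_add, smul_add]
    exact I.add_mem hu hv

lemma locSubmodule_div_mul_self
    (hfin : ∀ r : R, r ≠ 0 → {M : Ideal R | M.IsMaximal ∧ r ∈ M}.Finite)
    (huniq : ∀ P : Ideal R, P.IsPrime → P ≠ ⊥ → ∃! M : Ideal R, M.IsMaximal ∧ P ≤ M)
    (M : Ideal R) [hM : M.IsMaximal] {I : Submodule R K} (hI : IsFrac R K I) :
    locSubmodule M (I / (I * I)) =
      locSubmodule M I / (locSubmodule M I * locSubmodule M I) := by
  apply le_antisymm
  · rw [← locSubmodule_mul]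
    exact locSubmodule_div_le _ _
  · intro x hx
    obtain ⟨e, he, hex⟩ := exists_smul_mul_mul_mem hI x
    obtain ⟨s, hs, hsN⟩ := exists_notMem_forall_dvd_mul hfin huniq hM he
    refine ⟨s, hs, Submodule.mem_div_iff_forall_mul_mem.mpr fun y hy => ?_⟩
    apply mem_of_forall_mem_locSubmodule
    intro N hN
    rw [smul_mul_assoc]
    by_cases hNM : N = M
    · subst hNM
      rw [← locSubmodule_mul] at hx
      obtain ⟨n, hn, hny⟩ :=
        Submodule.mem_div_iff_forall_mul_mem.mp hx y (mem_locSubmodule_of_mem hy)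
      refine ⟨n, hn, ?_⟩
      rw [smul_comm]
      exact I.smul_mem s hny
    · obtain ⟨n, hn, r, hr⟩ := hsN N hN hNM
      refine ⟨n, hn, ?_⟩
      rw [smul_smul, hr, mul_comm, mul_smul]
      exact I.smul_mem r (hex y hy)

end HLocal

/-- Let `R` be an h-local domain: every nonzero element lies in only
finitely many maximal ideals and every nonzero prime is contained in a unique maximal ideal.
Then `R` is Clifford regular iff `R_M` is Clifford regular for every maximal ideal `M`, and
`R` is stable iff `R_M` is stable for every maximal ideal `M`. -/
theorem hlocal_clifford_regular_and_stable_local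
    {R K : Type*} [CommRing R] [IsDomain R] [Field K] [Algebra R K] [IsFractionRing R K]
    (hfin : ∀ r : R, r ≠ 0 → {M : Ideal R | M.IsMaximal ∧ r ∈ M}.Finite)
    (huniq : ∀ P : Ideal R, P.IsPrime → P ≠ ⊥ → ∃! M : Ideal R, M.IsMaximal ∧ P ≤ M) :
    (CliffordRegularDomain R K ↔
        ∀ M : Ideal R, M.IsMaximal → CliffordRegularDomain (locAlg R K M) K) ∧
      (StableDomain R K ↔
        ∀ M : Ideal R, M.IsMaximal → StableDomain (locAlg R K M) K) := by
  refine ⟨⟨fun h M hM X hX => ?_, fun h I hI => ?_⟩, ⟨fun h M hM X hX => ?_, fun h I hI => ?_⟩⟩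
  · obtain ⟨I, hI, rfl⟩ := exists_isFrac_locSubmodule_eq hX
    obtain ⟨J, -, hIJ⟩ := h I hI
    have heq : locSubmodule M I = locSubmodule M I * locSubmodule M I * locSubmodule M J := by
      rw [← locSubmodule_mul, ← locSubmodule_mul, ← hIJ]
    refine ⟨locSubmodule M J, fun h0 => hX.1 ?_, heq⟩
    rw [heq, h0, Submodule.mul_bot]
  · have hle : I * I * (I / (I * I)) ≤ I := by
      rw [mul_comm]
      exact Submodule.le_div_iff_mul_le.mp le_rfl
    have heq : I = I * I * (I / (I * I)) := by
      refine le_antisymm (fun z hz => mem_of_forall_mem_locSubmodule fun M hM => ?_) hle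
      obtain ⟨J, -, hJ⟩ := h M hM _ hI.locSubmodule
      rw [locSubmodule_mul, locSubmodule_mul, locSubmodule_div_mul_self hfin huniq M hI,
        ← eq_mul_mul_div_of_eq_mul_mul hJ]
      exact mem_locSubmodule_of_mem hz
    refine ⟨I / (I * I), fun h0 => hI.1 ?_, heq⟩
    rw [heq, h0, Submodule.mul_bot]
  · obtain ⟨I, hI, rfl⟩ := exists_isFrac_locSubmodule_eq hX
    have h1 := mem_locSubmodule_of_mem (P := M) ((isStableIdeal_iff_one_mem I).mp (h I hI))
    rw [locSubmodule_mul] at h1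
    rw [isStableIdeal_iff_one_mem, ← locSubmodule_mul I I]
    exact mul_le_mul_right (locSubmodule_div_le _ _) _ h1
  · rw [isStableIdeal_iff_one_mem]
    refine mem_of_forall_mem_locSubmodule fun M hM => ?_
    rw [locSubmodule_mul, locSubmodule_div_mul_self hfin huniq M hI]
    exact (isStableIdeal_iff_one_mem _).mp (h M hM _ hI.locSubmodule)
end
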